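/- arXiv:1402.4282 — 2 statements merged into one kernel-verified Lean document; each statement's English description precedes it below -/
import Mathlib

section
/- Let X be a Hausdorff topological space which contains an uncountable closed discrete subset. Then the product space ω₁ × (ω₁ + 1) (where each factor carries its order topology) embeds into (CL(X), τ_F) as a closed subspace; that is, there is a map from ω₁ × (ω₁ + 1) to CL(X) which is a closed embedding with respect to the Fell topology. -/
open Set Topology Ordinal

noncomputable section

/-- `CL X` is the hyperspace of nonempty closed subsets of `X`. -/
def CL (X : Type*) [TopologicalSpace X] : Type _ := {A : Set X // A.Nonempty ∧ IsClosed A}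

/-- The Fell topology on `CL X`, generated by the subbase consisting of the sets
`U⁻ = {A : A ∩ U ≠ ∅}` for `U` open and `(Kᶜ)⁺ = {A : A ⊆ Kᶜ}` for `K` compact. -/
def fellTopology (X : Type*) [TopologicalSpace X] : TopologicalSpace (CL X) :=
  TopologicalSpace.generateFrom
    ({S | ∃ U : Set X, IsOpen U ∧ S = {A : CL X | (A.1 ∩ U).Nonempty}} ∪
     {S | ∃ K : Set X, IsCompact K ∧ S = {A : CL X | A.1 ⊆ Kᶜ}})

theorem Ordinal.isClopen_Iic (a : Ordinal) : IsClopen (Iic a) :=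
  ⟨isClosed_Iic, Order.Iio_succ a ▸ isOpen_Iio⟩

theorem Ordinal.isCompact_Iic (a : Ordinal) : IsCompact (Iic a) :=
  Icc_bot (a := a) ▸ isCompact_Icc

theorem Ordinal.isCompact_preimage_val_Iic {p : Ordinal → Prop} {a : Ordinal}
    (h : ∀ o ≤ a, p o) : IsCompact ((↑) ⁻¹' Iic a : Set {o // p o}) := by
  refine Subtype.isCompact_iff.2 ?_
  convert isCompact_Iic a
  exact (Subtype.image_preimage_coe _ _).trans (inter_eq_right.2 h)

theorem isClosed_of_subset_of_discreteTopology {X : Type*} [TopologicalSpace X] {D S : Set X}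
    (hD : IsClosed D) (hdisc : DiscreteTopology D) (hS : S ⊆ D) : IsClosed S := by
  have := hD.isClosedEmbedding_subtypeVal.isClosedMap _ (isClosed_discrete ((↑) ⁻¹' S : Set D))
  rwa [Subtype.image_preimage_coe, inter_eq_right.2 hS] at this

theorem exists_isClosedEmbedding_fellTopology {X Z ι : Type*} [TopologicalSpace X]
    [TopologicalSpace Z] {D : Set X} (hD : IsClosed D) (hdisc : DiscreteTopology D)
    (d : ι → X) (hd : Function.Injective d) (hdD : ∀ i, d i ∈ D)
    (C : ι → Set Z) (hclopen : ∀ i, IsClopen (C i)) (hcompact : ∀ i, IsCompact (C i))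
    (hcover : ∀ z, ∃ i, z ∈ C i) (hsep : ∀ z w, (∀ i, z ∈ C i ↔ w ∈ C i) → z = w) :
    ∃ f : Z → CL X, @IsClosedEmbedding _ _ _ (fellTopology X) f := by
  let _ := fellTopology X
  have hclosed : ∀ I : Set ι, IsClosed (d '' I) := fun I =>
    isClosed_of_subset_of_discreteTopology hD hdisc (by rintro _ ⟨i, -, rfl⟩; exact hdD i)
  let f : Z → CL X := fun z =>
    ⟨d '' {i | z ∈ C i}, (show {i | z ∈ C i}.Nonempty from hcover z).image d, hclosed _⟩
  have hmem : ∀ z i, d i ∈ (f z).1 ↔ z ∈ C i := fun z i => hd.mem_set_image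
  have hit : ∀ U : Set X, IsOpen U → IsOpen {A : CL X | (A.1 ∩ U).Nonempty} := fun U hU =>
    TopologicalSpace.isOpen_generateFrom_of_mem (.inl ⟨U, hU, rfl⟩)
  have miss : ∀ K : Set X, IsCompact K → IsOpen {A : CL X | A.1 ⊆ Kᶜ} := fun K hK =>
    TopologicalSpace.isOpen_generateFrom_of_mem (.inr ⟨K, hK, rfl⟩)
  have hcont : Continuous f := by
    refine continuous_generateFrom_iff.2 ?_
    rintro _ (⟨U, -, rfl⟩ | ⟨K, hK, rfl⟩)
    · have : f ⁻¹' {A : CL X | (A.1 ∩ U).Nonempty} = ⋃ i ∈ d ⁻¹' U, C i := by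
        ext z
        simp only [mem_preimage, mem_ofPred_eq, mem_iUnion, exists_prop]
        constructor
        · rintro ⟨_, ⟨i, hi, rfl⟩, hU⟩
          exact ⟨i, hU, hi⟩
        · rintro ⟨i, hU, hi⟩
          exact ⟨d i, ⟨i, hi, rfl⟩, hU⟩
      rw [this]
      exact isOpen_biUnion fun i _ => (hclopen i).isOpen
    · have : f ⁻¹' {A : CL X | A.1 ⊆ Kᶜ} = ⋂ i ∈ d ⁻¹' K, (C i)ᶜ := by
        ext z
        simp only [mem_preimage, mem_ofPred_eq, mem_iInter, mem_compl_iff]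
        constructor
        · intro h i hK hi
          exact h ⟨i, hi, rfl⟩ hK
        · rintro h _ ⟨i, hi, rfl⟩ hK
          exact h i hK hi
      have hfin : (K ∩ D).Finite :=
        (hK.inter_right hD).finite ⟨DiscreteTopology.of_subset hdisc inter_subset_right⟩
      have hfin' : (d ⁻¹' K).Finite :=
        (hfin.preimage hd.injOn).subset fun i hi => ⟨hi, hdD i⟩
      rw [this]
      exact hfin'.isOpen_biInter fun i _ => (hclopen i).compl.isOpen
  have hproper : IsProperMap f := by
    refine isProperMap_iff_ultrafilter.2 ⟨hcont, fun F A hA => ?_⟩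
    have hsub : A.1 ⊆ range d := by
      intro x hx
      by_contra hxd
      have hopen : IsOpen (range d)ᶜ := (image_univ (f := d) ▸ hclosed univ).isOpen_compl
      obtain ⟨z, _, ⟨i, -, rfl⟩, hy⟩ :=
        (hA.eventually ((hit _ hopen).mem_nhds ⟨x, hx, hxd⟩)).exists
      exact hy ⟨i, rfl⟩
    have hin : ∀ i, d i ∈ A.1 → C i ∈ F := by
      intro i hi
      have hopen : IsOpen (d '' {i}ᶜ)ᶜ := (hclosed _).isOpen_compl
      filter_upwards [hA.eventually ((hit _ hopen).mem_nhds
        ⟨d i, hi, fun h => (hd.mem_set_image.1 h) rfl⟩)]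
      rintro z ⟨_, ⟨j, hj, rfl⟩, hy⟩
      by_cases hij : j = i
      · exact hij ▸ hj
      · exact (hy ⟨j, hij, rfl⟩).elim
    have hout : ∀ i, d i ∉ A.1 → (C i)ᶜ ∈ F := by
      intro i hi
      filter_upwards [hA.eventually ((miss _ isCompact_singleton).mem_nhds
        (subset_compl_singleton_iff.2 hi))] with z hz hzi
      exact hz ((hmem z i).2 hzi) rfl
    obtain ⟨x, hx⟩ := A.2.1
    obtain ⟨i, rfl⟩ := hsub hx
    obtain ⟨z, -, hz⟩ := (hcompact i).ultrafilter_le_nhds F (Filter.le_principal_iff.2 (hin i hx))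
    refine ⟨z, Subtype.ext ?_, hz⟩
    have key : ∀ j, d j ∈ (f z).1 ↔ d j ∈ A.1 := by
      intro j
      rw [hmem]
      constructor
      · intro hj
        by_contra hjA
        exact F.compl_mem_iff_notMem.1 (hout j hjA) (hz ((hclopen j).isOpen.mem_nhds hj))
      · intro hjA
        by_contra hj
        exact F.compl_mem_iff_notMem.1 (hz ((hclopen j).compl.isOpen.mem_nhds hj)) (hin j hjA)
    refine Subset.antisymm ?_ fun y hy => ?_
    · rintro _ ⟨j, hj, rfl⟩
      exact (key j).1 ((hmem z j).2 hj)
    · obtain ⟨j, rfl⟩ := hsub hy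
      exact (key j).2 hy
  refine ⟨f, .of_continuous_injective_isClosedMap hcont (fun z w h => hsep z w fun i => ?_)
    hproper.isClosedMap⟩
  rw [← hmem, ← hmem, h]

theorem Ordinal.mk_lt_omega_one : Cardinal.mk {o : Ordinal // o < ω₁} = Cardinal.aleph 1 := by
  have := Cardinal.mk_Iio_ordinal ω₁
  rw [card_omega, Cardinal.lift_aleph, Ordinal.lift_one] at this
  exact this

theorem Ordinal.mk_le_omega_one : Cardinal.mk {o : Ordinal // o ≤ ω₁} = Cardinal.aleph 1 := by
  have := Cardinal.mk_Iio_ordinal (Order.succ ω₁)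
  rw [Order.Iio_succ, Order.succ_eq_add_one, card_add_one, card_omega,
    Cardinal.add_one_eq (Cardinal.aleph0_le_aleph 1), Cardinal.lift_aleph, Ordinal.lift_one] at this
  exact this

theorem exists_injective_omega_one_prod {X : Type*} {D : Set X} (hD : ¬ D.Countable) :
    ∃ d : {o : Ordinal // o < ω₁} × {o : Ordinal // o ≤ ω₁} → X,
      Function.Injective d ∧ ∀ i, d i ∈ D := by
  have h_aleph : Cardinal.aleph 1 ≤ Cardinal.mk D := by
    rw [← Cardinal.succ_aleph0, Order.succ_le_iff]
    exact not_le.1 fun h => hD (Cardinal.le_aleph0_iff_set_countable.1 h)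
  obtain ⟨e⟩ := (Cardinal.lift_mk_le'
    (α := {o : Ordinal // o < ω₁} × {o : Ordinal // o ≤ ω₁}) (β := D)).1 <| by
    simp only [Cardinal.mk_prod, Ordinal.mk_lt_omega_one, Ordinal.mk_le_omega_one,
      Cardinal.lift_aleph, Ordinal.lift_one, Cardinal.aleph_mul_aleph, max_self]
    simpa using h_aleph
  exact ⟨fun i => e i, Subtype.val_injective.comp e.injective, fun i => (e i).2⟩

/-- If a Hausdorff space `X` contains an uncountable closed discrete subset, then the
product space `ω₁ × (ω₁ + 1)` embeds into `(CL X, τ_F)` as a closed subspace. -/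
theorem omega1_prod_closedEmbedding_fell {X : Type*} [TopologicalSpace X] [T2Space X]
    (D : Set X) (hD_unc : ¬ D.Countable) (hD_closed : IsClosed D)
    (hD_disc : DiscreteTopology D) :
    ∃ f : {o : Ordinal // o < ω₁} × {o : Ordinal // o ≤ ω₁} → CL X,
      @IsClosedEmbedding _ _ _ (fellTopology X) f := by
  obtain ⟨d, hd, hdD⟩ := exists_injective_omega_one_prod hD_unc
  refine exists_isClosedEmbedding_fellTopology hD_closed hD_disc d hd hdD
    (fun i => (Subtype.val ⁻¹' Iic i.1.1) ×ˢ (Subtype.val ⁻¹' Iic i.2.1)) (fun i => ?_) (fun i => ?_)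
    (fun z => ⟨z, le_refl z.1.1, le_refl z.2.1⟩) fun z w h => ?_
  · exact ((Ordinal.isClopen_Iic _).preimage continuous_subtype_val).prod
      ((Ordinal.isClopen_Iic _).preimage continuous_subtype_val)
  · exact (Ordinal.isCompact_preimage_val_Iic fun o ho => ho.trans_lt i.1.2).prod
      (Ordinal.isCompact_preimage_val_Iic fun o ho => ho.trans i.2.2)
  · have hzw := (h w).2 ⟨le_refl w.1.1, le_refl w.2.1⟩
    have hwz := (h z).1 ⟨le_refl z.1.1, le_refl z.2.1⟩
    exact Prod.ext (Subtype.ext (le_antisymm hzw.1 hwz.1)) (Subtype.ext (le_antisymm hzw.2 hwz.2))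
end
end

section
/- Let (X,d) be a metric space such that every closed ball in X that is a proper subset of X is totally bounded. Then the hyperspace (CL(X), τ_{w(d)}) with the Wijsman topology is a normal topological space if and only if (CL(X), τ_{w(d)}) is metrizable. -/
open Set Topology Ordinal

noncomputable section

/-- The Wijsman topology on `CL X` for a metric space `(X, d)`: the weakest topology
making each distance functional `A ↦ d(x, A)` continuous. -/
def wijsmanTopology (X : Type*) [MetricSpace X] : TopologicalSpace (CL X) :=
  ⨅ x : X, TopologicalSpace.induced (fun A : CL X => Metric.infDist x A.1) inferInstance

/-- A set of pairwise distances at least `ε > 0` meets a totally bounded set in a finite set. -/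
theorem TotallyBounded.finite_of_pairwise_le_dist {X : Type*} [PseudoMetricSpace X] {s : Set X}
    (hs : TotallyBounded s) {ε : ℝ} (hε : 0 < ε) (hsep : s.Pairwise fun x y => ε ≤ dist x y) :
    s.Finite := by
  obtain ⟨t, ht, hst⟩ := Metric.totallyBounded_iff.1 hs (ε / 2) (half_pos hε)
  have hcov : ∀ x ∈ s, ∃ y ∈ t, dist x y < ε / 2 := fun x hx => by simpa using hst hx
  choose! f hft hf using hcov
  refine Set.Finite.of_finite_image (ht.subset (image_subset_iff.2 hft)) fun x hx y hy hxy => ?_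
  by_contra hne
  have h₁ := hsep hx hy hne
  have h₂ := hf x hx
  have h₃ := hf y hy
  rw [← show f x = f y from hxy] at h₃
  linarith [dist_triangle_right x y (f x)]

/-- A metric space without uncountable uniformly separated subsets is separable. -/
theorem secondCountableTopology_of_countable_separated {X : Type*} [PseudoMetricSpace X]
    (h : ∀ ε > 0, ∀ s : Set X, (s.Pairwise fun x y => ε ≤ dist x y) → s.Countable) :
    SecondCountableTopology X := by
  refine Metric.secondCountable_of_almost_dense_set fun ε hε => ?_
  obtain ⟨s, hs⟩ := zorn_subset {s : Set X | s.Pairwise fun x y => ε ≤ dist x y}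
    fun c hc hchain => ⟨⋃₀ c, (pairwise_sUnion hchain.directedOn).2 hc,
      fun t ht => subset_sUnion_of_mem ht⟩
  refine ⟨s, h ε hε s hs.prop, fun x => ?_⟩
  by_contra! hx
  have hins : (insert x s).Pairwise fun x y => ε ≤ dist x y :=
    pairwise_insert.2 ⟨hs.prop, fun y hy _ => ⟨(hx y hy).le, dist_comm x y ▸ (hx y hy).le⟩⟩
  have hxs : x ∈ s := hs.le_of_ge hins (subset_insert x s) (mem_insert x s)
  exact absurd (hx x hxs) (by simpa using hε.le)

namespace CL

variable {X : Type*} [MetricSpace X]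

attribute [local instance] wijsmanTopology

/-- The set `{x, y}` as a point of the hyperspace. -/
def pair (x y : X) : CL X :=
  ⟨{x, y}, insert_nonempty _ _, (toFinite _).isClosed⟩

theorem pair_self_subset {x : X} {s : Set X} (hx : x ∈ s) : (pair x x).1 ⊆ s :=
  insert_subset hx (singleton_subset_iff.2 hx)

theorem pair_comm (x y : X) : pair x y = pair y x :=
  Subtype.ext (Set.pair_comm x y)

theorem infDist_pair (x a b : X) :
    Metric.infDist x (pair a b).1 = min (dist x a) (dist x b) := by
  change Metric.infDist x ({a, b} : Set X) = _
  rw [← Set.singleton_union, Metric.infDist, Metric.infEDist_union, Metric.infEDist_singleton,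
    Metric.infEDist_singleton, ENNReal.toReal_min (edist_ne_top _ _) (edist_ne_top _ _),
    dist_edist, dist_edist]

theorem tendsto_nhds_iff {ι : Type*} {l : Filter ι} {f : ι → CL X} {A : CL X} :
    Filter.Tendsto f l (𝓝 A) ↔
      ∀ x, Filter.Tendsto (fun i => Metric.infDist x (f i).1) l (𝓝 (Metric.infDist x A.1)) := by
  have h : 𝓝 A = ⨅ x : X, Filter.comap (fun B : CL X => Metric.infDist x B.1)
      (𝓝 (Metric.infDist x A.1)) :=
    nhds_iInf.trans (iInf_congr fun x => nhds_induced _ _)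
  rw [h, Filter.tendsto_iInf]
  exact forall_congr' fun x => Filter.tendsto_comap_iff

theorem continuous_infDist (x : X) : Continuous fun A : CL X => Metric.infDist x A.1 :=
  continuous_iff_continuousAt.2 fun _ => tendsto_nhds_iff.1 Filter.tendsto_id x

/-- The closed sets contained in a fixed closed set form a closed subset of the hyperspace. -/
theorem isClosed_setOf_subset {C : Set X} (hC : IsClosed C) : IsClosed {A : CL X | A.1 ⊆ C} := by
  rcases C.eq_empty_or_nonempty with rfl | hne
  · convert isClosed_empty
    exact eq_empty_of_forall_notMem fun A hA => A.2.1.ne_empty (subset_empty_iff.1 hA)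
  have : {A : CL X | A.1 ⊆ C} =
      ⋂ x : X, {A : CL X | Metric.infDist x C ≤ Metric.infDist x A.1} := by
    ext A
    simp only [mem_ofPred_eq, mem_iInter]
    refine ⟨fun h x => Metric.infDist_le_infDist_of_subset h A.2.1, fun h x hx => ?_⟩
    rw [hC.mem_iff_infDist_zero hne]
    exact le_antisymm ((h x).trans_eq (Metric.infDist_zero_of_mem hx)) Metric.infDist_nonneg
  rw [this]
  exact isClosed_iInter fun x => isClosed_le continuous_const (continuous_infDist x)

/-- If proper closed balls are totally bounded, then along any infinite uniformly separated
set the pairs `{a, e}` converge to `{a}`. -/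
theorem tendsto_pair
    (h_balls : ∀ (x : X) (r : ℝ), Metric.closedBall x r ≠ Set.univ →
      TotallyBounded (Metric.closedBall x r))
    {E : Set X} {ε : ℝ} (hε : 0 < ε) (hE : E.Pairwise fun x y => ε ≤ dist x y) (a : X) :
    Filter.Tendsto (fun e : E => pair a (e : X)) Filter.cofinite (𝓝 (pair a a)) := by
  refine tendsto_nhds_iff.2 fun x => ?_
  simp only [infDist_pair, min_self]
  refine tendsto_order.2 ⟨fun r hr => ?_, fun r hr => .of_forall fun e => min_lt_of_left_lt hr⟩
  have hball : Metric.closedBall x r ≠ Set.univ := fun h => by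
    have : a ∈ Metric.closedBall x r := h ▸ mem_univ a
    rw [Metric.mem_closedBall'] at this
    exact this.not_gt hr
  have hfin : (E ∩ Metric.closedBall x r).Finite :=
    ((h_balls x r hball).subset inter_subset_right).finite_of_pairwise_le_dist hε
      (hE.mono inter_subset_left)
  refine Filter.eventually_cofinite.2
    ((hfin.preimage Subtype.val_injective.injOn).subset fun e he => ⟨e.2, ?_⟩)
  simp only [mem_ofPred_eq, lt_min_iff, hr, true_and, not_lt] at he
  exact Metric.mem_closedBall'.2 he

theorem countable_of_pairwise_le_dist [NormalSpace (CL X)]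
    (h_balls : ∀ (x : X) (r : ℝ), Metric.closedBall x r ≠ Set.univ →
      TotallyBounded (Metric.closedBall x r))
    {E : Set X} {ε : ℝ} (hε : 0 < ε) (hE : E.Pairwise fun x y => ε ≤ dist x y) :
    E.Countable := by
  by_contra hunc
  obtain ⟨C, hCE, hC, hCinf⟩ :=
    Set.Infinite.exists_subset_countable_infinite fun h : E.Finite => hunc h.countable
  have hclosed : ∀ s ⊆ E, IsClosed s := fun s hs =>
    Metric.isClosed_of_pairwise_le_dist hε (hE.mono hs)
  have hdisj : Disjoint {A : CL X | A.1 ⊆ C} {A : CL X | A.1 ⊆ E \ C} :=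
    disjoint_left.2 fun A h₁ h₂ => by
      obtain ⟨x, hx⟩ := A.2.1
      exact (h₂ hx).2 (h₁ hx)
  obtain ⟨U, V, hU, hV, hCU, hDV, hUV⟩ := normal_separation
    (isClosed_setOf_subset (hclosed C hCE)) (isClosed_setOf_subset (hclosed _ sdiff_subset)) hdisj
  have hfin : ∀ W : Set (CL X), IsOpen W → ∀ a, pair a a ∈ W →
      {e ∈ E | pair a e ∉ W}.Finite := fun W hW a ha => by
    have h := Filter.eventually_cofinite.1
      ((tendsto_pair h_balls hε hE a).eventually (hW.mem_nhds ha))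
    refine (h.image Subtype.val).subset ?_
    rintro e ⟨he, heW⟩
    exact ⟨⟨e, he⟩, heW, rfl⟩
  have hU_fin : ∀ a ∈ C, {e ∈ E | pair a e ∉ U}.Finite := fun a ha =>
    hfin U hU a (hCU (pair_self_subset ha))
  obtain ⟨b, hbE, hb⟩ : ∃ b ∈ E, b ∉ C ∪ ⋃ a ∈ C, {e ∈ E | pair a e ∉ U} :=
    not_subset.1 fun h =>
      hunc ((hC.union (hC.biUnion fun a ha => (hU_fin a ha).countable)).mono h)
  simp only [mem_union, mem_iUnion, mem_ofPred_eq, not_or, not_exists, not_and, not_not] at hb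
  have hV_fin : {e ∈ E | pair b e ∉ V}.Finite :=
    hfin V hV b (hDV (pair_self_subset ⟨hbE, hb.1⟩))
  obtain ⟨a, haC, ha⟩ := (hCinf.sdiff hV_fin).nonempty
  have haV : pair b a ∈ V := by
    by_contra h
    exact ha ⟨hCE haC, h⟩
  exact disjoint_left.1 hUV (hb.2 a haC hbE) (pair_comm b a ▸ haV)

theorem injective_infDist_of_dense {D : Set X} (hD : Dense D) :
    Function.Injective fun (A : CL X) (x : D) => Metric.infDist (x : X) A.1 := by
  intro A B hAB
  have h : (fun x => Metric.infDist x A.1) = fun x => Metric.infDist x B.1 :=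
    (Metric.continuous_infDist_pt A.1).ext_on hD (Metric.continuous_infDist_pt B.1)
      fun x hx => congrFun hAB ⟨x, hx⟩
  refine Subtype.ext (Set.ext fun x => ?_)
  rw [A.2.2.mem_iff_infDist_zero A.2.1, B.2.2.mem_iff_infDist_zero B.2.1, congrFun h x]

theorem isInducing_infDist_of_dense {D : Set X} (hD : Dense D) :
    IsInducing fun (A : CL X) (x : D) => Metric.infDist (x : X) A.1 := by
  refine ⟨le_antisymm (continuous_pi fun x : D => continuous_infDist (x : X)).le_induced
    (le_iInf fun x => ?_)⟩
  rw [← continuous_iff_le_induced]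
  let _ : TopologicalSpace (CL X) := TopologicalSpace.induced
    (fun (A : CL X) (x : D) => Metric.infDist (x : X) A.1) inferInstance
  refine continuous_of_uniform_approx_of_continuous fun u hu => ?_
  obtain ⟨δ, hδ, hu⟩ := Metric.mem_uniformity_dist.1 hu
  obtain ⟨y, hyD, hxy⟩ := hD.exists_dist_lt x hδ
  refine ⟨fun A => Metric.infDist y A.1,
    (continuous_apply (⟨y, hyD⟩ : D)).comp
      (continuous_induced_dom (f := fun (A : CL X) (x : D) => Metric.infDist (x : X) A.1)), fun A => hu ?_⟩
  exact ((Metric.lipschitz_infDist_pt A.1).dist_le_mul x y).trans_lt (by simpa using hxy)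

theorem metrizableSpace [TopologicalSpace.SeparableSpace X] :
    TopologicalSpace.MetrizableSpace (CL X) := by
  obtain ⟨D, hDc, hD⟩ := TopologicalSpace.exists_countable_dense X
  have : Countable D := hDc
  exact IsEmbedding.metrizableSpace
    ⟨isInducing_infDist_of_dense hD, injective_infDist_of_dense hD⟩

end CL

/-- If `(X, d)` is a metric space in which every closed ball that is a proper subset
of `X` is totally bounded, then `(CL X, τ_{w(d)})` is normal iff it is metrizable. -/
theorem wijsman_normal_iff_metrizable {X : Type*} [MetricSpace X]
    (h_balls : ∀ (x : X) (r : ℝ), Metric.closedBall x r ≠ Set.univ →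
      TotallyBounded (Metric.closedBall x r)) :
    @NormalSpace (CL X) (wijsmanTopology X) ↔
      @TopologicalSpace.MetrizableSpace (CL X) (wijsmanTopology X) := by
  let _ := wijsmanTopology X
  refine ⟨fun hnormal => ?_, fun hmetrizable => inferInstance⟩
  have : SecondCountableTopology X :=
    secondCountableTopology_of_countable_separated fun ε hε E hE =>
      CL.countable_of_pairwise_le_dist h_balls hε hE
  exact CL.metrizableSpace
end
end
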